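/- Let k be a commutative ring and let (H, S_H) and (L, S_L) be coquasi-bialgebras over k with preantipodes, both flat as k-modules. Then every morphism of coquasi-bialgebras f : H → L satisfies f ∘ S_H = S_L ∘ f. -/

import Mathlib

open scoped TensorProduct
open TensorProduct

/-- A coquasi-bialgebra structure on a coassociative counital `k`-coalgebra `H`:
a multiplication `mul` (a coalgebra morphism, given in curried bilinear form), a unit `one`,
and a convolution-invertible trilinear reassociator `ω` (with convolution inverse `ωInv`),
subject to the cocycle condition, unitality, and quasi-associativity.
Sweedler-type identities are stated for arbitrary finite representations of the
comultiplications involved. -/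
structure CoquasiBialgebra (k H : Type*) [CommRing k] [AddCommGroup H] [Module k H]
    [Coalgebra k H] where
  mul : H →ₗ[k] H →ₗ[k] H
  one : H
  ω : H →ₗ[k] H →ₗ[k] H →ₗ[k] k
  ωInv : H →ₗ[k] H →ₗ[k] H →ₗ[k] k
  /-- `mul` is comultiplicative: `Δ(xy) = ∑ x₁y₁ ⊗ x₂y₂`. -/
  comul_mul : ∀ (x y : H) (n m : ℕ) (x1 x2 : Fin n → H) (y1 y2 : Fin m → H),
    Coalgebra.comul (R := k) x = ∑ i, x1 i ⊗ₜ[k] x2 i →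
    Coalgebra.comul (R := k) y = ∑ j, y1 j ⊗ₜ[k] y2 j →
    Coalgebra.comul (R := k) (mul x y) =
      ∑ i, ∑ j, mul (x1 i) (y1 j) ⊗ₜ[k] mul (x2 i) (y2 j)
  counit_mul : ∀ x y, Coalgebra.counit (R := k) (mul x y) =
      Coalgebra.counit (R := k) x * Coalgebra.counit (R := k) y
  comul_one : Coalgebra.comul (R := k) one = one ⊗ₜ[k] one
  counit_one : Coalgebra.counit (R := k) one = 1
  one_mul : ∀ h, mul one h = h
  mul_one : ∀ h, mul h one = h
  /-- `ω(x ⊗ 1 ⊗ y) = ε(x)ε(y)`. -/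
  ω_one : ∀ x y, ω x one y = Coalgebra.counit (R := k) x * Coalgebra.counit (R := k) y
  /-- `ωInv` is the two-sided convolution inverse of `ω`. -/
  ω_conv_inv : ∀ (x y z : H) (n m p : ℕ) (x1 x2 : Fin n → H) (y1 y2 : Fin m → H)
    (z1 z2 : Fin p → H),
    Coalgebra.comul (R := k) x = ∑ i, x1 i ⊗ₜ[k] x2 i →
    Coalgebra.comul (R := k) y = ∑ j, y1 j ⊗ₜ[k] y2 j →
    Coalgebra.comul (R := k) z = ∑ l, z1 l ⊗ₜ[k] z2 l →
    (∑ i, ∑ j, ∑ l, ω (x1 i) (y1 j) (z1 l) * ωInv (x2 i) (y2 j) (z2 l) =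
      Coalgebra.counit (R := k) x * Coalgebra.counit (R := k) y *
        Coalgebra.counit (R := k) z) ∧
    (∑ i, ∑ j, ∑ l, ωInv (x1 i) (y1 j) (z1 l) * ω (x2 i) (y2 j) (z2 l) =
      Coalgebra.counit (R := k) x * Coalgebra.counit (R := k) y *
        Coalgebra.counit (R := k) z)
  /-- The 3-cocycle condition:
  `∑ ω(x₁ ⊗ y₁ ⊗ z₁w₁) ω(x₂y₂ ⊗ z₂ ⊗ w₂)
    = ∑ ω(y₁ ⊗ z₁ ⊗ w₁) ω(x₁ ⊗ y₂z₂ ⊗ w₂) ω(x₂ ⊗ y₃ ⊗ z₃)`. -/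
  cocycle : ∀ (x y z w : H) (nx ny nz nw : ℕ)
    (x1 x2 : Fin nx → H) (y1 y2 : Fin ny → H) (z1 z2 : Fin nz → H) (w1 w2 : Fin nw → H)
    (my : Fin ny → ℕ) (y21 y22 : ∀ j, Fin (my j) → H)
    (mz : Fin nz → ℕ) (z21 z22 : ∀ l, Fin (mz l) → H),
    Coalgebra.comul (R := k) x = ∑ i, x1 i ⊗ₜ[k] x2 i →
    Coalgebra.comul (R := k) y = ∑ j, y1 j ⊗ₜ[k] y2 j →
    Coalgebra.comul (R := k) z = ∑ l, z1 l ⊗ₜ[k] z2 l →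
    Coalgebra.comul (R := k) w = ∑ r, w1 r ⊗ₜ[k] w2 r →
    (∀ j, Coalgebra.comul (R := k) (y2 j) = ∑ p, y21 j p ⊗ₜ[k] y22 j p) →
    (∀ l, Coalgebra.comul (R := k) (z2 l) = ∑ q, z21 l q ⊗ₜ[k] z22 l q) →
    ∑ i, ∑ j, ∑ l, ∑ r,
        ω (x1 i) (y1 j) (mul (z1 l) (w1 r)) * ω (mul (x2 i) (y2 j)) (z2 l) (w2 r) =
      ∑ i, ∑ j, ∑ p, ∑ l, ∑ q, ∑ r,
        ω (y1 j) (z1 l) (w1 r) * ω (x1 i) (mul (y21 j p) (z21 l q)) (w2 r) *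
          ω (x2 i) (y22 j p) (z22 l q)
  /-- Quasi-associativity: `∑ x₁(y₁z₁) ω(x₂ ⊗ y₂ ⊗ z₂) = ∑ ω(x₁ ⊗ y₁ ⊗ z₁) (x₂y₂)z₂`. -/
  quasi_assoc : ∀ (x y z : H) (n m p : ℕ) (x1 x2 : Fin n → H) (y1 y2 : Fin m → H)
    (z1 z2 : Fin p → H),
    Coalgebra.comul (R := k) x = ∑ i, x1 i ⊗ₜ[k] x2 i →
    Coalgebra.comul (R := k) y = ∑ j, y1 j ⊗ₜ[k] y2 j →
    Coalgebra.comul (R := k) z = ∑ l, z1 l ⊗ₜ[k] z2 l →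
    ∑ i, ∑ j, ∑ l, ω (x2 i) (y2 j) (z2 l) • mul (x1 i) (mul (y1 j) (z1 l)) =
      ∑ i, ∑ j, ∑ l, ω (x1 i) (y1 j) (z1 l) • mul (mul (x2 i) (y2 j)) (z2 l)

/-- A preantipode for a coquasi-bialgebra: a `k`-linear endomorphism `S` with
(P1) `∑ S(h₁)₁h₂ ⊗ S(h₁)₂ = 1 ⊗ S(h)`, (P2) `∑ S(h₂)₁ ⊗ h₁S(h₂)₂ = S(h) ⊗ 1`,
(P3) `∑ ω(h₁ ⊗ S(h₂) ⊗ h₃) = ε(h)`. -/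
def CoquasiBialgebra.IsPreantipode {k H : Type*} [CommRing k] [AddCommGroup H] [Module k H]
    [Coalgebra k H] (B : CoquasiBialgebra k H) (S : H →ₗ[k] H) : Prop :=
  (∀ (h : H) (n : ℕ) (a b : Fin n → H) (m : Fin n → ℕ) (c d : ∀ i, Fin (m i) → H),
    Coalgebra.comul (R := k) h = ∑ i, a i ⊗ₜ[k] b i →
    (∀ i, Coalgebra.comul (R := k) (S (a i)) = ∑ p, c i p ⊗ₜ[k] d i p) →
    ∑ i, ∑ p, B.mul (c i p) (b i) ⊗ₜ[k] d i p = B.one ⊗ₜ[k] S h) ∧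
  (∀ (h : H) (n : ℕ) (a b : Fin n → H) (m : Fin n → ℕ) (c d : ∀ i, Fin (m i) → H),
    Coalgebra.comul (R := k) h = ∑ i, a i ⊗ₜ[k] b i →
    (∀ i, Coalgebra.comul (R := k) (S (b i)) = ∑ p, c i p ⊗ₜ[k] d i p) →
    ∑ i, ∑ p, c i p ⊗ₜ[k] B.mul (a i) (d i p) = S h ⊗ₜ[k] B.one) ∧
  (∀ (h : H) (n : ℕ) (a b : Fin n → H) (m : Fin n → ℕ) (c d : ∀ i, Fin (m i) → H),
    Coalgebra.comul (R := k) h = ∑ i, a i ⊗ₜ[k] b i →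
    (∀ i, Coalgebra.comul (R := k) (b i) = ∑ p, c i p ⊗ₜ[k] d i p) →
    ∑ i, ∑ p, B.ω (a i) (S (c i p)) (d i p) = Coalgebra.counit (R := k) h)

open Coalgebra (comul counit)
open scoped Coalgebra

namespace CoalgebraConvolution

section Convolution

variable {k C D E M N P Q R : Type*} [CommRing k]
  [AddCommGroup C] [Module k C] [Coalgebra k C] [AddCommGroup D] [Module k D] [Coalgebra k D]
  [AddCommGroup E] [Module k E] [Coalgebra k E]
  [AddCommGroup M] [Module k M] [AddCommGroup N] [Module k N] [AddCommGroup P] [Module k P]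
  [AddCommGroup Q] [Module k Q] [AddCommGroup R] [Module k R]

/-- The convolution product `c ↦ ∑ p (α c₁) (β c₂)` along a bilinear map `p`. -/
noncomputable def conv (p : M →ₗ[k] N →ₗ[k] P) (α : C →ₗ[k] M) (β : C →ₗ[k] N) : C →ₗ[k] P :=
  lift p ∘ₗ TensorProduct.map α β ∘ₗ comul

/-- The convolution action of functionals on module-valued maps from the left. -/
noncomputable abbrev lconv (α : C →ₗ[k] k) (β : C →ₗ[k] M) : C →ₗ[k] M :=
  conv (LinearMap.lsmul k M) α β

/-- The convolution action of functionals on module-valued maps from the right. -/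
noncomputable abbrev rconv (β : C →ₗ[k] M) (α : C →ₗ[k] k) : C →ₗ[k] M :=
  conv (LinearMap.lsmul k M).flip β α

lemma conv_apply_of_comul_eq (p : M →ₗ[k] N →ₗ[k] P) (α : C →ₗ[k] M) (β : C →ₗ[k] N)
    {ι : Type*} {s : Finset ι} {c : C} {l r : ι → C}
    (h : comul (R := k) c = ∑ i ∈ s, l i ⊗ₜ[k] r i) :
    conv p α β c = ∑ i ∈ s, p (α (l i)) (β (r i)) := by
  simp [conv, h]

lemma conv_assoc (p : P →ₗ[k] Q →ₗ[k] R) (q : M →ₗ[k] N →ₗ[k] P)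
    {P' : Type*} [AddCommGroup P'] [Module k P']
    (p' : M →ₗ[k] P' →ₗ[k] R) (q' : N →ₗ[k] Q →ₗ[k] P')
    (h : ∀ x y z, p (q x y) z = p' x (q' y z))
    (α : C →ₗ[k] M) (β : C →ₗ[k] N) (γ : C →ₗ[k] Q) :
    conv p (conv q α β) γ = conv p' α (conv q' β γ) := by
  have key : lift p ∘ₗ TensorProduct.map (lift q ∘ₗ TensorProduct.map α β) γ =
      lift p' ∘ₗ TensorProduct.map α (lift q' ∘ₗ TensorProduct.map β γ) ∘ₗ
        (TensorProduct.assoc k C C C).toLinearMap := by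
    ext x y z
    simp [h]
  ext c
  have h1 := congr($key (comul.rTensor C (comul (R := k) c)))
  simp only [LinearMap.comp_apply, LinearEquiv.coe_coe, Coalgebra.coassoc_apply] at h1
  simp only [LinearMap.rTensor, LinearMap.lTensor, TensorProduct.map_map, LinearMap.comp_id,
    LinearMap.comp_assoc] at h1
  simpa [conv, LinearMap.comp_assoc] using h1

lemma lconv_lconv (α β : C →ₗ[k] k) (γ : C →ₗ[k] M) :
    lconv (lconv α β) γ = lconv α (lconv β γ) :=
  conv_assoc _ _ _ _ (fun a b x => by simp [mul_smul, smul_comm b a]) _ _ _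

lemma rconv_rconv (γ : C →ₗ[k] M) (α β : C →ₗ[k] k) :
    rconv (rconv γ α) β = rconv γ (lconv α β) :=
  conv_assoc _ _ _ _ (fun x a b => by simp [mul_smul, smul_comm a b x]) _ _ _

lemma rconv_lconv (α : C →ₗ[k] k) (γ : C →ₗ[k] M) (β : C →ₗ[k] k) :
    rconv (lconv α γ) β = lconv α (rconv γ β) :=
  conv_assoc _ _ _ _ (fun a x b => by simp [smul_comm a b x]) _ _ _

lemma conv_comp (p : M →ₗ[k] N →ₗ[k] P) (α : C →ₗ[k] M) (β : C →ₗ[k] N) (g : D →ₗc[k] C) :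
    conv p (α ∘ₗ g.toLinearMap) (β ∘ₗ g.toLinearMap) = conv p α β ∘ₗ g.toLinearMap := by
  simp [conv, LinearMap.comp_assoc, TensorProduct.map_comp]

lemma conv_counit_left (p : k →ₗ[k] N →ₗ[k] P) (β : C →ₗ[k] N) :
    conv p counit β = p 1 ∘ₗ β := by
  ext c
  have := congr(lift p (TensorProduct.map LinearMap.id β
    $(Coalgebra.rTensor_counit_comul (R := k) c)))
  simpa [conv, LinearMap.rTensor, TensorProduct.map_map,
    -Coalgebra.rTensor_counit_comul] using this

lemma conv_counit_right (p : M →ₗ[k] k →ₗ[k] P) (α : C →ₗ[k] M) :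
    conv p α counit = p.flip 1 ∘ₗ α := by
  ext c
  have := congr(lift p (TensorProduct.map α LinearMap.id
    $(Coalgebra.lTensor_counit_comul (R := k) c)))
  simpa [conv, LinearMap.lTensor, TensorProduct.map_map,
    -Coalgebra.lTensor_counit_comul] using this

lemma lconv_counit (β : C →ₗ[k] M) : lconv counit β = β :=
  (conv_counit_left _ _).trans (by ext; simp)

lemma rconv_counit (β : C →ₗ[k] M) : rconv β counit = β :=
  (conv_counit_right _ _).trans (by ext; simp)

lemma lconv_counit_right (α : C →ₗ[k] k) : lconv α counit = α :=
  (conv_counit_right _ _).trans (by ext; simp)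

lemma comul_tmul_eq_sum {ι κ : Type*} {s : Finset ι} {t : Finset κ} {c : C} {d : D}
    {c1 c2 : ι → C} {d1 d2 : κ → D} (hc : comul (R := k) c = ∑ i ∈ s, c1 i ⊗ₜ[k] c2 i)
    (hd : comul (R := k) d = ∑ j ∈ t, d1 j ⊗ₜ[k] d2 j) :
    comul (R := k) (c ⊗ₜ[k] d) =
      ∑ x ∈ s ×ˢ t, (c1 x.1 ⊗ₜ[k] d1 x.2) ⊗ₜ[k] (c2 x.1 ⊗ₜ[k] d2 x.2) := by
  simp [hc, hd, sum_tmul, tmul_sum, Finset.sum_product_right]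

lemma conv_tmul_left (p : M →ₗ[k] N →ₗ[k] P) (α : C ⊗[k] D →ₗ[k] M) (β : C ⊗[k] D →ₗ[k] N)
    {ι : Type*} {s : Finset ι} {d : D} {d1 d2 : ι → D}
    (h : comul (R := k) d = ∑ i ∈ s, d1 i ⊗ₜ[k] d2 i) (c : C) :
    conv p α β (c ⊗ₜ d) = ∑ i ∈ s, conv p (α ∘ₗ (TensorProduct.mk k C D).flip (d1 i))
      (β ∘ₗ (TensorProduct.mk k C D).flip (d2 i)) c := by
  have hc := (ℛ k c).eq.symm
  simp [conv_apply_of_comul_eq _ _ _ (comul_tmul_eq_sum hc h), conv_apply_of_comul_eq _ _ _ hc,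
    Finset.sum_product_right]

lemma conv_tmul_right (p : M →ₗ[k] N →ₗ[k] P) (α : C ⊗[k] D →ₗ[k] M) (β : C ⊗[k] D →ₗ[k] N)
    {ι : Type*} {s : Finset ι} {c : C} {c1 c2 : ι → C}
    (h : comul (R := k) c = ∑ i ∈ s, c1 i ⊗ₜ[k] c2 i) (d : D) :
    conv p α β (c ⊗ₜ d) = ∑ i ∈ s, conv p (α ∘ₗ TensorProduct.mk k C D (c1 i))
      (β ∘ₗ TensorProduct.mk k C D (c2 i)) d := by
  have hd := (ℛ k d).eq.symm
  simp [conv_apply_of_comul_eq _ _ _ (comul_tmul_eq_sum h hd), conv_apply_of_comul_eq _ _ _ hd,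
    Finset.sum_product]

variable (k C D) in
/-- The projection `c ⊗ d ↦ ε(d) c`. -/
noncomputable def projLeft : C ⊗[k] D →ₗc[k] C :=
  (Coalgebra.TensorProduct.rid k k C).toCoalgHom.comp
    (Coalgebra.TensorProduct.map (CoalgHom.id k C) (Coalgebra.counitCoalgHom k D))

variable (k C D) in
/-- The projection `c ⊗ d ↦ ε(c) d`. -/
noncomputable def projRight : C ⊗[k] D →ₗc[k] D :=
  (Coalgebra.TensorProduct.lid k D).toCoalgHom.comp
    (Coalgebra.TensorProduct.map (Coalgebra.counitCoalgHom k C) (CoalgHom.id k D))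

@[simp] lemma projLeft_tmul (c : C) (d : D) :
    projLeft k C D (c ⊗ₜ d) = counit (R := k) d • c := by
  simp [projLeft]

@[simp] lemma projRight_tmul (c : C) (d : D) :
    projRight k C D (c ⊗ₜ d) = counit (R := k) c • d := by
  simp [projRight]

lemma sum_counit_smul_right {ι : Type*} {s : Finset ι} {c : C} {c1 c2 : ι → C}
    (h : comul (R := k) c = ∑ i ∈ s, c1 i ⊗ₜ[k] c2 i) :
    ∑ i ∈ s, counit (R := k) (c1 i) • c2 i = c := by
  simpa [h] using congr(TensorProduct.lid k C $(Coalgebra.rTensor_counit_comul (R := k) c))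

lemma sum_counit_smul_left {ι : Type*} {s : Finset ι} {c : C} {c1 c2 : ι → C}
    (h : comul (R := k) c = ∑ i ∈ s, c1 i ⊗ₜ[k] c2 i) :
    ∑ i ∈ s, counit (R := k) (c2 i) • c1 i = c := by
  simpa [h] using congr(TensorProduct.rid k C $(Coalgebra.lTensor_counit_comul (R := k) c))

/-- Tensoring on the left with a group-like element. -/
noncomputable def mkLeft (D : Type*) [AddCommGroup D] [Module k D] [Coalgebra k D] (g : C)
    (hg : counit (R := k) g = 1) (hg' : comul (R := k) g = g ⊗ₜ[k] g) : D →ₗc[k] C ⊗[k] D where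
  __ := TensorProduct.mk k C D g
  counit_comp := by ext; simp [hg]
  map_comp_comul := by
    ext d
    have hd := (ℛ k d).eq.symm
    simp [TensorProduct.comul_tmul, hg', hd, tmul_sum]

/-- Tensoring on the right with a group-like element. -/
noncomputable def mkRight (D : Type*) [AddCommGroup D] [Module k D] [Coalgebra k D] (g : C)
    (hg : counit (R := k) g = 1) (hg' : comul (R := k) g = g ⊗ₜ[k] g) : D →ₗc[k] D ⊗[k] C where
  __ := (TensorProduct.mk k D C).flip g
  counit_comp := by ext; simp [hg]
  map_comp_comul := by
    ext d
    have hd := (ℛ k d).eq.symm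
    simp [TensorProduct.comul_tmul, hg', hd, sum_tmul]

section Coinvariant

variable {V : Type*} [AddCommGroup V] [Module k V] {g : C →ₗ[k] V} {e : V} {θ : C}

lemma conv_coinvariant_tmul_left (hθ : TensorProduct.map g LinearMap.id (comul (R := k) θ) = e ⊗ₜ θ)
    (p : M →ₗ[k] N →ₗ[k] P) (α : V ⊗[k] D →ₗ[k] M) (β : C ⊗[k] D →ₗ[k] N) (t : D) :
    conv p (α ∘ₗ TensorProduct.map g LinearMap.id) β (θ ⊗ₜ t) =
      conv p (α ∘ₗ TensorProduct.mk k V D e) (β ∘ₗ TensorProduct.mk k C D θ) t := by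
  have h := (ℛ k θ).eq.symm
  have ht := (ℛ k t).eq.symm
  rw [h] at hθ
  simp only [map_sum, TensorProduct.map_tmul, LinearMap.id_apply] at hθ
  rw [conv_tmul_right _ _ _ h, conv_apply_of_comul_eq _ _ _ ht]
  simp only [conv_apply_of_comul_eq _ _ _ ht]
  rw [Finset.sum_comm]
  refine Finset.sum_congr rfl fun j _ => ?_
  have := congr(lift (p.compl₁₂ (α ∘ₗ (TensorProduct.mk k V D).flip ((ℛ k t).left j))
    (β ∘ₗ (TensorProduct.mk k C D).flip ((ℛ k t).right j))) $hθ)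
  simpa using this

lemma conv_coinvariant_tmul_right
    (hθ : TensorProduct.map g LinearMap.id (comul (R := k) θ) = e ⊗ₜ θ)
    (p : M →ₗ[k] N →ₗ[k] P) (α : D ⊗[k] V →ₗ[k] M) (β : D ⊗[k] C →ₗ[k] N) (t : D) :
    conv p (α ∘ₗ TensorProduct.map LinearMap.id g) β (t ⊗ₜ θ) =
      conv p (α ∘ₗ (TensorProduct.mk k D V).flip e)
        (β ∘ₗ (TensorProduct.mk k D C).flip θ) t := by
  have h := (ℛ k θ).eq.symm
  have ht := (ℛ k t).eq.symm
  rw [h] at hθ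
  simp only [map_sum, TensorProduct.map_tmul, LinearMap.id_apply] at hθ
  rw [conv_tmul_left _ _ _ h, conv_apply_of_comul_eq _ _ _ ht]
  simp only [conv_apply_of_comul_eq _ _ _ ht]
  rw [Finset.sum_comm]
  refine Finset.sum_congr rfl fun j _ => ?_
  have := congr(lift (p.compl₁₂ (α ∘ₗ TensorProduct.mk k D V ((ℛ k t).left j))
    (β ∘ₗ TensorProduct.mk k D C ((ℛ k t).right j))) $hθ)
  simpa using this

lemma conv_tmul_left_coinvariant
    (hθ : TensorProduct.map LinearMap.id g (comul (R := k) θ) = θ ⊗ₜ e)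
    (p : M →ₗ[k] N →ₗ[k] P) (α : C ⊗[k] D →ₗ[k] M) (β : V ⊗[k] D →ₗ[k] N) (t : D) :
    conv p α (β ∘ₗ TensorProduct.map g LinearMap.id) (θ ⊗ₜ t) =
      conv p (α ∘ₗ TensorProduct.mk k C D θ) (β ∘ₗ TensorProduct.mk k V D e) t := by
  have h := (ℛ k θ).eq.symm
  have ht := (ℛ k t).eq.symm
  rw [h] at hθ
  simp only [map_sum, TensorProduct.map_tmul, LinearMap.id_apply] at hθ
  rw [conv_tmul_right _ _ _ h, conv_apply_of_comul_eq _ _ _ ht]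
  simp only [conv_apply_of_comul_eq _ _ _ ht]
  rw [Finset.sum_comm]
  refine Finset.sum_congr rfl fun j _ => ?_
  have := congr(lift (p.compl₁₂ (α ∘ₗ (TensorProduct.mk k C D).flip ((ℛ k t).left j))
    (β ∘ₗ (TensorProduct.mk k V D).flip ((ℛ k t).right j))) $hθ)
  simpa using this

lemma conv_tmul_right_coinvariant
    (hθ : TensorProduct.map LinearMap.id g (comul (R := k) θ) = θ ⊗ₜ e)
    (p : M →ₗ[k] N →ₗ[k] P) (α : D ⊗[k] C →ₗ[k] M) (β : D ⊗[k] V →ₗ[k] N) (t : D) :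
    conv p α (β ∘ₗ TensorProduct.map LinearMap.id g) (t ⊗ₜ θ) =
      conv p (α ∘ₗ (TensorProduct.mk k D C).flip θ)
        (β ∘ₗ (TensorProduct.mk k D V).flip e) t := by
  have h := (ℛ k θ).eq.symm
  have ht := (ℛ k t).eq.symm
  rw [h] at hθ
  simp only [map_sum, TensorProduct.map_tmul, LinearMap.id_apply] at hθ
  rw [conv_tmul_left _ _ _ h, conv_apply_of_comul_eq _ _ _ ht]
  simp only [conv_apply_of_comul_eq _ _ _ ht]
  rw [Finset.sum_comm]
  refine Finset.sum_congr rfl fun j _ => ?_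
  have := congr(lift (p.compl₁₂ (α ∘ₗ TensorProduct.mk k D C ((ℛ k t).left j))
    (β ∘ₗ TensorProduct.mk k D V ((ℛ k t).right j))) $hθ)
  simpa using this

lemma conv_coinvariant_tmul_mid
    (hθ : TensorProduct.map g LinearMap.id (comul (R := k) θ) = e ⊗ₜ θ)
    (p : M →ₗ[k] N →ₗ[k] P) (α : (D ⊗[k] V) ⊗[k] E →ₗ[k] M)
    (β : (D ⊗[k] C) ⊗[k] E →ₗ[k] N) (s : D) (t : E) :
    conv p (α ∘ₗ TensorProduct.map (TensorProduct.map LinearMap.id g) LinearMap.id) β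
        ((s ⊗ₜ θ) ⊗ₜ t) =
      conv p (α ∘ₗ TensorProduct.map ((TensorProduct.mk k D V).flip e) LinearMap.id)
        (β ∘ₗ TensorProduct.map ((TensorProduct.mk k D C).flip θ) LinearMap.id) (s ⊗ₜ t) := by
  have ht := (ℛ k t).eq.symm
  rw [conv_tmul_left _ _ _ ht, conv_tmul_left _ _ _ ht]
  exact Finset.sum_congr rfl fun j _ => conv_coinvariant_tmul_right hθ p
    (α ∘ₗ (TensorProduct.mk k (D ⊗[k] V) E).flip ((ℛ k t).left j)) _ s

lemma conv_tmul_mid_coinvariant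
    (hθ : TensorProduct.map LinearMap.id g (comul (R := k) θ) = θ ⊗ₜ e)
    (p : M →ₗ[k] N →ₗ[k] P) (α : (D ⊗[k] C) ⊗[k] E →ₗ[k] M)
    (β : (D ⊗[k] V) ⊗[k] E →ₗ[k] N) (s : D) (t : E) :
    conv p α (β ∘ₗ TensorProduct.map (TensorProduct.map LinearMap.id g) LinearMap.id)
        ((s ⊗ₜ θ) ⊗ₜ t) =
      conv p (α ∘ₗ TensorProduct.map ((TensorProduct.mk k D C).flip θ) LinearMap.id)
        (β ∘ₗ TensorProduct.map ((TensorProduct.mk k D V).flip e) LinearMap.id) (s ⊗ₜ t) := by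
  have ht := (ℛ k t).eq.symm
  rw [conv_tmul_left _ _ _ ht, conv_tmul_left _ _ _ ht]
  exact Finset.sum_congr rfl fun j _ => conv_tmul_right_coinvariant hθ p _
    (β ∘ₗ (TensorProduct.mk k (D ⊗[k] V) E).flip ((ℛ k t).right j)) s

end Coinvariant

lemma conv_comp_projLeft (p : M →ₗ[k] N →ₗ[k] P) (α : C ⊗[k] D →ₗ[k] M) (β : C →ₗ[k] N)
    (s : C) (v : D) :
    conv p α (β ∘ₗ (projLeft k C D).toLinearMap) (s ⊗ₜ v) =
      conv p (α ∘ₗ (TensorProduct.mk k C D).flip v) β s := by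
  have hv : TensorProduct.map LinearMap.id counit (comul (R := k) v) = v ⊗ₜ[k] (1 : k) :=
    Coalgebra.lTensor_counit_comul v
  have h := conv_tmul_right_coinvariant hv p α
    (β ∘ₗ (TensorProduct.rid k C).toLinearMap) s
  convert h using 2
  · congr 1
  · congr 1
    ext; simp

lemma conv_projRight_comp (p : M →ₗ[k] N →ₗ[k] P) (α : D →ₗ[k] M) (β : C ⊗[k] D →ₗ[k] N)
    (v : C) (t : D) :
    conv p (α ∘ₗ (projRight k C D).toLinearMap) β (v ⊗ₜ t) =
      conv p α (β ∘ₗ TensorProduct.mk k C D v) t := by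
  have hv : TensorProduct.map counit LinearMap.id (comul (R := k) v) = (1 : k) ⊗ₜ[k] v :=
    Coalgebra.rTensor_counit_comul v
  have h := conv_coinvariant_tmul_left hv p
    (α ∘ₗ (TensorProduct.lid k D).toLinearMap) β t
  convert h using 2
  · congr 1
  · congr 1
    ext; simp

end Convolution

end CoalgebraConvolution

open CoalgebraConvolution

namespace CoquasiBialgebra

section Trilinear

variable {k L : Type*} [CommRing k] [AddCommGroup L] [Module k L]

/-- A trilinear form as a functional on `(L ⊗ L) ⊗ L`. -/
noncomputable def triL (φ : L →ₗ[k] L →ₗ[k] L →ₗ[k] k) : (L ⊗[k] L) ⊗[k] L →ₗ[k] k :=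
  lift (lift φ)

@[simp] lemma triL_tmul (φ : L →ₗ[k] L →ₗ[k] L →ₗ[k] k) (x y z : L) :
    triL φ ((x ⊗ₜ y) ⊗ₜ z) = φ x y z := by simp [triL]

end Trilinear

variable {k L : Type*} [CommRing k] [AddCommGroup L] [Module k L] [Coalgebra k L]
  (B : CoquasiBialgebra k L)

/-- The multiplication as a coalgebra homomorphism. -/
noncomputable def mulHom : L ⊗[k] L →ₗc[k] L where
  __ := lift B.mul
  counit_comp := by
    ext x y
    simp [B.counit_mul, mul_comm]
  map_comp_comul := by
    ext x y
    obtain ⟨n, x1, x2, hx⟩ := TensorProduct.exists_sum_tmul_eq (comul (R := k) x)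
    obtain ⟨m, y1, y2, hy⟩ := TensorProduct.exists_sum_tmul_eq (comul (R := k) y)
    simp [comul_tmul_eq_sum hx hy, B.comul_mul x y n m x1 x2 y1 y2 hx hy,
      -Finset.univ_product_univ, Finset.sum_product]

@[simp] lemma mulHom_tmul (x y : L) : B.mulHom (x ⊗ₜ y) = B.mul x y := by
  simp [mulHom, ← CoalgHom.coe_toLinearMap]

lemma triL_ω_conv_triL_ωInv : lconv (triL B.ω) (triL B.ωInv) = counit := by
  ext x y z
  obtain ⟨n, x1, x2, hx⟩ := TensorProduct.exists_sum_tmul_eq (comul (R := k) x)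
  obtain ⟨m, y1, y2, hy⟩ := TensorProduct.exists_sum_tmul_eq (comul (R := k) y)
  obtain ⟨p, z1, z2, hz⟩ := TensorProduct.exists_sum_tmul_eq (comul (R := k) z)
  have := (B.ω_conv_inv x y z n m p x1 x2 y1 y2 z1 z2 hx hy hz).1
  simpa [conv_apply_of_comul_eq _ _ _ (comul_tmul_eq_sum (comul_tmul_eq_sum hx hy) hz),
    -Finset.univ_product_univ, Finset.sum_product, mul_comm] using this

lemma triL_ωInv_conv_triL_ω : lconv (triL B.ωInv) (triL B.ω) = counit := by
  ext x y z
  obtain ⟨n, x1, x2, hx⟩ := TensorProduct.exists_sum_tmul_eq (comul (R := k) x)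
  obtain ⟨m, y1, y2, hy⟩ := TensorProduct.exists_sum_tmul_eq (comul (R := k) y)
  obtain ⟨p, z1, z2, hz⟩ := TensorProduct.exists_sum_tmul_eq (comul (R := k) z)
  have := (B.ω_conv_inv x y z n m p x1 x2 y1 y2 z1 z2 hx hy hz).2
  simpa [conv_apply_of_comul_eq _ _ _ (comul_tmul_eq_sum (comul_tmul_eq_sum hx hy) hz),
    -Finset.univ_product_univ, Finset.sum_product, mul_comm] using this

variable {C : Type*} [AddCommGroup C] [Module k C] [Coalgebra k C]

lemma triL_ω_comp_conv_triL_ωInv_comp (g : C →ₗc[k] (L ⊗[k] L) ⊗[k] L) :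
    lconv (triL B.ω ∘ₗ g.toLinearMap) (triL B.ωInv ∘ₗ g.toLinearMap) = counit := by
  rw [lconv, conv_comp, ← lconv, triL_ω_conv_triL_ωInv, g.counit_comp]

lemma triL_ωInv_comp_conv_triL_ω_comp (g : C →ₗc[k] (L ⊗[k] L) ⊗[k] L) :
    lconv (triL B.ωInv ∘ₗ g.toLinearMap) (triL B.ω ∘ₗ g.toLinearMap) = counit := by
  rw [lconv, conv_comp, ← lconv, triL_ωInv_conv_triL_ω, g.counit_comp]

variable (k L) in
/-- The rebracketing `((x ⊗ (y ⊗ z)) ⊗ w) ↦ (x ⊗ y) ⊗ (z ⊗ w)`. -/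
noncomputable def pairUp : (L ⊗[k] (L ⊗[k] L)) ⊗[k] L →ₗc[k] (L ⊗[k] L) ⊗[k] (L ⊗[k] L) :=
  (Coalgebra.TensorProduct.assoc k k L L (L ⊗[k] L)).symm.toCoalgHom.comp
    ((Coalgebra.TensorProduct.map (CoalgHom.id k L)
      (Coalgebra.TensorProduct.assoc k k L L L).toCoalgHom).comp
    (Coalgebra.TensorProduct.assoc k k L (L ⊗[k] L) L).toCoalgHom)

variable (k L) in
/-- The rebracketing `(x ⊗ y) ⊗ (z ⊗ w) ↦ (x ⊗ (y ⊗ z)) ⊗ w`. -/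
noncomputable def groupMid : (L ⊗[k] L) ⊗[k] (L ⊗[k] L) →ₗc[k] (L ⊗[k] (L ⊗[k] L)) ⊗[k] L :=
  (Coalgebra.TensorProduct.assoc k k L (L ⊗[k] L) L).symm.toCoalgHom.comp
    ((Coalgebra.TensorProduct.map (CoalgHom.id k L)
      (Coalgebra.TensorProduct.assoc k k L L L).symm.toCoalgHom).comp
    (Coalgebra.TensorProduct.assoc k k L L (L ⊗[k] L)).toCoalgHom)

variable (k L) in
/-- The rebracketing `x ⊗ (y ⊗ z) ↦ (x ⊗ y) ⊗ z`. -/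
noncomputable def assocInv : L ⊗[k] (L ⊗[k] L) →ₗc[k] (L ⊗[k] L) ⊗[k] L :=
  (Coalgebra.TensorProduct.assoc k k L L L).symm.toCoalgHom

@[simp] lemma pairUp_tmul (x y z w : L) :
    pairUp k L ((x ⊗ₜ (y ⊗ₜ z)) ⊗ₜ w) = (x ⊗ₜ y) ⊗ₜ (z ⊗ₜ w) := rfl

@[simp] lemma groupMid_tmul (x y z w : L) :
    groupMid k L ((x ⊗ₜ y) ⊗ₜ (z ⊗ₜ w)) = (x ⊗ₜ (y ⊗ₜ z)) ⊗ₜ w := rfl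

@[simp] lemma assocInv_tmul (x y z : L) :
    assocInv k L (x ⊗ₜ (y ⊗ₜ z)) = (x ⊗ₜ y) ⊗ₜ z := rfl

/-- `(x ⊗ y) ⊗ (z ⊗ w) ↦ (xy ⊗ z) ⊗ w`. -/
noncomputable def mulFirst : (L ⊗[k] L) ⊗[k] (L ⊗[k] L) →ₗc[k] (L ⊗[k] L) ⊗[k] L :=
  (assocInv k L).comp (Coalgebra.TensorProduct.map B.mulHom (CoalgHom.id k (L ⊗[k] L)))

/-- `(x ⊗ y) ⊗ (z ⊗ w) ↦ (x ⊗ yz) ⊗ w`. -/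
noncomputable def mulMid : (L ⊗[k] L) ⊗[k] (L ⊗[k] L) →ₗc[k] (L ⊗[k] L) ⊗[k] L :=
  (Coalgebra.TensorProduct.map (Coalgebra.TensorProduct.map (CoalgHom.id k L) B.mulHom)
    (CoalgHom.id k L)).comp (groupMid k L)

/-- `(x ⊗ y) ⊗ (z ⊗ w) ↦ (x ⊗ y) ⊗ zw`. -/
noncomputable def mulLast : (L ⊗[k] L) ⊗[k] (L ⊗[k] L) →ₗc[k] (L ⊗[k] L) ⊗[k] L :=
  Coalgebra.TensorProduct.map (CoalgHom.id k (L ⊗[k] L)) B.mulHom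

variable (k L) in
/-- `(x ⊗ y) ⊗ (z ⊗ w) ↦ ε(x) (y ⊗ z) ⊗ w`. -/
noncomputable def dropFirst : (L ⊗[k] L) ⊗[k] (L ⊗[k] L) →ₗc[k] (L ⊗[k] L) ⊗[k] L :=
  (assocInv k L).comp
    (Coalgebra.TensorProduct.map (projRight k L L) (CoalgHom.id k (L ⊗[k] L)))

variable (k L) in
/-- `(x ⊗ y) ⊗ (z ⊗ w) ↦ ε(w) (x ⊗ y) ⊗ z`. -/
noncomputable def dropLast : (L ⊗[k] L) ⊗[k] (L ⊗[k] L) →ₗc[k] (L ⊗[k] L) ⊗[k] L :=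
  Coalgebra.TensorProduct.map (CoalgHom.id k (L ⊗[k] L)) (projLeft k L L)

@[simp] lemma mulFirst_tmul (x y z w : L) :
    B.mulFirst ((x ⊗ₜ y) ⊗ₜ (z ⊗ₜ w)) = (B.mul x y ⊗ₜ z) ⊗ₜ w := by
  simp [mulFirst]

@[simp] lemma mulMid_tmul (x y z w : L) :
    B.mulMid ((x ⊗ₜ y) ⊗ₜ (z ⊗ₜ w)) = (x ⊗ₜ B.mul y z) ⊗ₜ w := by
  simp [mulMid]

@[simp] lemma mulLast_tmul (x y z w : L) :
    B.mulLast ((x ⊗ₜ y) ⊗ₜ (z ⊗ₜ w)) = (x ⊗ₜ y) ⊗ₜ B.mul z w := by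
  simp [mulLast]

@[simp] lemma dropFirst_tmul (x y z w : L) :
    dropFirst k L ((x ⊗ₜ y) ⊗ₜ (z ⊗ₜ w)) = counit (R := k) x • ((y ⊗ₜ z) ⊗ₜ w) := by
  simp [dropFirst, smul_tmul']

@[simp] lemma dropLast_tmul (x y z w : L) :
    dropLast k L ((x ⊗ₜ y) ⊗ₜ (z ⊗ₜ w)) = counit (R := k) w • ((x ⊗ₜ y) ⊗ₜ z) := by
  simp [dropLast]

lemma conv_mulMid_dropLast_tmul {ι κ ν : Type*} {s : Finset ι} {t : Finset κ} {u : Finset ν}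
    {x y z : L} {x1 x2 : ι → L} {y1 y2 : κ → L} {z1 z2 : ν → L}
    (hx : comul (R := k) x = ∑ i ∈ s, x1 i ⊗ₜ[k] x2 i)
    (hy : comul (R := k) y = ∑ i ∈ t, y1 i ⊗ₜ[k] y2 i)
    (hz : comul (R := k) z = ∑ i ∈ u, z1 i ⊗ₜ[k] z2 i) (w : L) :
    lconv (triL B.ω ∘ₗ B.mulMid.toLinearMap) (triL B.ω ∘ₗ (dropLast k L).toLinearMap)
      ((x ⊗ₜ y) ⊗ₜ (z ⊗ₜ w)) =
    ∑ i ∈ s, ∑ p ∈ t, ∑ q ∈ u,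
      B.ω (x1 i) (B.mul (y1 p) (z1 q)) w * B.ω (x2 i) (y2 p) (z2 q) := by
  have hw := (ℛ k w).eq.symm
  conv_rhs => rw [← sum_counit_smul_left hw]
  simp [conv_apply_of_comul_eq _ _ _
    (comul_tmul_eq_sum (comul_tmul_eq_sum hx hy) (comul_tmul_eq_sum hz hw)),
    Finset.sum_product, Finset.sum_mul]
  refine Finset.sum_congr rfl fun _ _ => Finset.sum_congr rfl fun _ _ =>
    Finset.sum_congr rfl fun _ _ => Finset.sum_congr rfl fun _ _ => by ring

lemma cocycle_conv :
    lconv (triL B.ω ∘ₗ B.mulLast.toLinearMap) (triL B.ω ∘ₗ B.mulFirst.toLinearMap) =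
      lconv (triL B.ω ∘ₗ (dropFirst k L).toLinearMap)
        (lconv (triL B.ω ∘ₗ B.mulMid.toLinearMap)
          (triL B.ω ∘ₗ (dropLast k L).toLinearMap)) := by
  ext x y z w
  obtain ⟨nx, x1, x2, hx⟩ := TensorProduct.exists_sum_tmul_eq (comul (R := k) x)
  obtain ⟨ny, y1, y2, hy⟩ := TensorProduct.exists_sum_tmul_eq (comul (R := k) y)
  obtain ⟨nz, z1, z2, hz⟩ := TensorProduct.exists_sum_tmul_eq (comul (R := k) z)
  obtain ⟨nw, w1, w2, hw⟩ := TensorProduct.exists_sum_tmul_eq (comul (R := k) w)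
  choose my y21 y22 hy2 using fun j => TensorProduct.exists_sum_tmul_eq (comul (R := k) (y2 j))
  choose mz z21 z22 hz2 using fun j => TensorProduct.exists_sum_tmul_eq (comul (R := k) (z2 j))
  have key := B.cocycle x y z w nx ny nz nw x1 x2 y1 y2 z1 z2 w1 w2 my y21 y22 mz z21 z22
    hx hy hz hw hy2 hz2
  have hC := comul_tmul_eq_sum (comul_tmul_eq_sum hx hy) (comul_tmul_eq_sum hz hw)
  have hR : lconv (triL B.ω ∘ₗ (dropFirst k L).toLinearMap)
        (lconv (triL B.ω ∘ₗ B.mulMid.toLinearMap)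
          (triL B.ω ∘ₗ (dropLast k L).toLinearMap)) ((x ⊗ₜ y) ⊗ₜ (z ⊗ₜ w)) =
      ∑ j, ∑ l, ∑ r, B.ω (y1 j) (z1 l) (w1 r) *
        lconv (triL B.ω ∘ₗ B.mulMid.toLinearMap)
          (triL B.ω ∘ₗ (dropLast k L).toLinearMap) ((x ⊗ₜ y2 j) ⊗ₜ (z2 l ⊗ₜ w2 r)) := by
    rw [conv_apply_of_comul_eq _ _ _ hC]
    conv_rhs => rw [← sum_counit_smul_right hx]
    simp only [sum_tmul, map_sum, Finset.mul_sum, Finset.sum_product]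
    rw [Finset.sum_comm]
    refine Finset.sum_congr rfl fun j _ => ?_
    rw [Finset.sum_comm]
    refine Finset.sum_congr rfl fun l _ => ?_
    rw [Finset.sum_comm]
    refine Finset.sum_congr rfl fun r _ => Finset.sum_congr rfl fun i _ => ?_
    simp [← smul_tmul']
    ring
  have hL : lconv (triL B.ω ∘ₗ B.mulLast.toLinearMap) (triL B.ω ∘ₗ B.mulFirst.toLinearMap)
      ((x ⊗ₜ y) ⊗ₜ (z ⊗ₜ w)) = ∑ i, ∑ j, ∑ l, ∑ r,
        B.ω (x1 i) (y1 j) (B.mul (z1 l) (w1 r)) * B.ω (B.mul (x2 i) (y2 j)) (z2 l) (w2 r) := by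
    rw [conv_apply_of_comul_eq _ _ _ hC]
    simp [-Finset.univ_product_univ, Finset.sum_product]
  refine hL.trans (key.trans (Eq.trans ?_ hR.symm))
  simp only [B.conv_mulMid_dropLast_tmul hx (hy2 _) (hz2 _), Finset.mul_sum]
  rw [Finset.sum_comm]
  refine Finset.sum_congr rfl fun j _ => ?_
  simp only [fun l => Finset.sum_comm (s := (Finset.univ : Finset (Fin nw)))
    (t := (Finset.univ : Finset (Fin nx))) (f := fun r i => ∑ p, ∑ q, B.ω (y1 j) (z1 l) (w1 r) *
      (B.ω (x1 i) (B.mul (y21 j p) (z21 l q)) (w2 r) * B.ω (x2 i) (y22 j p) (z22 l q)))]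
  rw [Finset.sum_comm (s := (Finset.univ : Finset (Fin nz)))]
  refine Finset.sum_congr rfl fun i _ => ?_
  rw [Finset.sum_comm]
  refine Finset.sum_congr rfl fun l _ => ?_
  rw [Finset.sum_comm_cycle]
  simp only [mul_assoc]

lemma mulFirst_conv_dropLast_inv :
    lconv (triL B.ω ∘ₗ B.mulFirst.toLinearMap) (triL B.ωInv ∘ₗ (dropLast k L).toLinearMap) =
      lconv (triL B.ωInv ∘ₗ B.mulLast.toLinearMap)
        (lconv (triL B.ω ∘ₗ (dropFirst k L).toLinearMap)
          (triL B.ω ∘ₗ B.mulMid.toLinearMap)) := by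
  have h := congr(lconv (triL B.ωInv ∘ₗ B.mulLast.toLinearMap)
    (lconv $(B.cocycle_conv) (triL B.ωInv ∘ₗ (dropLast k L).toLinearMap)))
  rwa [lconv_lconv, ← lconv_lconv, triL_ωInv_comp_conv_triL_ω_comp, lconv_counit, lconv_lconv,
    lconv_lconv, triL_ω_comp_conv_triL_ωInv_comp, lconv_counit_right] at h

lemma dropFirst_inv_conv_mulLast :
    lconv (triL B.ωInv ∘ₗ (dropFirst k L).toLinearMap) (triL B.ω ∘ₗ B.mulLast.toLinearMap) =
      lconv (lconv (triL B.ω ∘ₗ B.mulMid.toLinearMap)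
        (triL B.ω ∘ₗ (dropLast k L).toLinearMap)) (triL B.ωInv ∘ₗ B.mulFirst.toLinearMap) := by
  have h := congr(lconv (triL B.ωInv ∘ₗ (dropFirst k L).toLinearMap)
    (lconv $(B.cocycle_conv) (triL B.ωInv ∘ₗ B.mulFirst.toLinearMap)))
  rwa [lconv_lconv, triL_ω_comp_conv_triL_ωInv_comp, lconv_counit_right, lconv_lconv,
    ← lconv_lconv (triL B.ωInv ∘ₗ (dropFirst k L).toLinearMap),
    triL_ωInv_comp_conv_triL_ω_comp, lconv_counit] at h

/-- `x ↦ 1 ⊗ x`. -/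
noncomputable def oneLeft (C : Type*) [AddCommGroup C] [Module k C] [Coalgebra k C] :
    C →ₗc[k] L ⊗[k] C := mkLeft C B.one B.counit_one B.comul_one

/-- `x ↦ x ⊗ 1`. -/
noncomputable def oneRight (C : Type*) [AddCommGroup C] [Module k C] [Coalgebra k C] :
    C →ₗc[k] C ⊗[k] L := mkRight C B.one B.counit_one B.comul_one

@[simp] lemma oneLeft_apply (c : C) : B.oneLeft C c = B.one ⊗ₜ c := rfl

@[simp] lemma oneRight_apply (c : C) : B.oneRight C c = c ⊗ₜ B.one := rfl

lemma ω_one_left (y z : L) : B.ω B.one y z = counit (R := k) y * counit (R := k) z := by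
  let j := Coalgebra.TensorProduct.map (B.oneRight L) (CoalgHom.id k (L ⊗[k] L))
  have h := congr($(B.cocycle_conv) ∘ₗ j.toLinearMap)
  simp only [lconv, ← conv_comp] at h
  have ha : (triL B.ω ∘ₗ B.mulLast.toLinearMap) ∘ₗ j.toLinearMap = counit := by
    ext; simp [j, B.ω_one, B.counit_mul]
    ring
  have hb : (triL B.ω ∘ₗ B.mulFirst.toLinearMap) ∘ₗ j.toLinearMap =
      triL B.ω ∘ₗ (assocInv k L).toLinearMap := by
    ext; simp [j, B.mul_one]
  have hd : (triL B.ω ∘ₗ B.mulMid.toLinearMap) ∘ₗ j.toLinearMap =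
      triL B.ω ∘ₗ (assocInv k L).toLinearMap := by
    ext; simp [j, B.one_mul]
  have he : (triL B.ω ∘ₗ (dropLast k L).toLinearMap) ∘ₗ j.toLinearMap = counit := by
    ext; simp [j, B.ω_one]
    ring
  rw [ha, hb, hd, he] at h
  change lconv _ _ = lconv _ (lconv _ _) at h
  rw [lconv_counit, lconv_counit_right] at h
  have h2 := congr(lconv $h (triL B.ωInv ∘ₗ (assocInv k L).toLinearMap))
  rw [lconv_lconv, triL_ω_comp_conv_triL_ωInv_comp, lconv_counit_right] at h2
  simpa [j, B.counit_one, mul_comm] using congr($h2 (B.one ⊗ₜ (y ⊗ₜ z))).symm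

lemma ω_one_right (x y : L) : B.ω x y B.one = counit (R := k) x * counit (R := k) y := by
  let j := Coalgebra.TensorProduct.map (CoalgHom.id k (L ⊗[k] L)) (B.oneLeft L)
  have h := congr($(B.cocycle_conv) ∘ₗ j.toLinearMap)
  simp only [lconv, ← conv_comp] at h
  have ha : (triL B.ω ∘ₗ B.mulLast.toLinearMap) ∘ₗ j.toLinearMap = triL B.ω := by
    ext; simp [j, B.one_mul]
  have hb : (triL B.ω ∘ₗ B.mulFirst.toLinearMap) ∘ₗ j.toLinearMap = counit := by
    ext; simp [j, B.ω_one, B.counit_mul]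
    ring
  have hc : (triL B.ω ∘ₗ (dropFirst k L).toLinearMap) ∘ₗ j.toLinearMap = counit := by
    ext; simp [j, B.ω_one]
    ring
  have hd : (triL B.ω ∘ₗ B.mulMid.toLinearMap) ∘ₗ j.toLinearMap = triL B.ω := by
    ext; simp [j, B.mul_one]
  rw [ha, hb, hc, hd] at h
  change lconv _ _ = lconv _ (lconv _ _) at h
  rw [lconv_counit, lconv_counit_right] at h
  have h2 := congr(lconv (triL B.ωInv) $h)
  rw [← lconv_lconv, triL_ωInv_conv_triL_ω, lconv_counit] at h2
  simpa [j, B.counit_one, mul_comm] using congr($h2 ((x ⊗ₜ y) ⊗ₜ B.one)).symm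

lemma ωInv_one_left (y z : L) : B.ωInv B.one y z = counit (R := k) y * counit (R := k) z := by
  have h := B.triL_ω_comp_conv_triL_ωInv_comp ((assocInv k L).comp (B.oneLeft (L ⊗[k] L)))
  have h1 : triL B.ω ∘ₗ ((assocInv k L).comp (B.oneLeft (L ⊗[k] L))).toLinearMap = counit := by
    ext; simp [B.ω_one_left, mul_comm]
  rw [h1, lconv_counit] at h
  simpa [mul_comm] using congr($h (y ⊗ₜ z))

lemma ωInv_one_right (x y : L) : B.ωInv x y B.one = counit (R := k) x * counit (R := k) y := by
  have h := B.triL_ω_comp_conv_triL_ωInv_comp (B.oneRight (L ⊗[k] L))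
  have h1 : triL B.ω ∘ₗ (B.oneRight (L ⊗[k] L)).toLinearMap = counit := by
    ext; simp [B.ω_one_right, mul_comm]
  rw [h1, lconv_counit] at h
  simpa [mul_comm] using congr($h (x ⊗ₜ y))

lemma ωInv_conv_mul :
    lconv (triL B.ωInv) (lift B.mul ∘ₗ TensorProduct.map LinearMap.id (lift B.mul) ∘ₗ
      (TensorProduct.assoc k L L L).toLinearMap) =
    rconv (lift B.mul ∘ₗ TensorProduct.map (lift B.mul) LinearMap.id) (triL B.ωInv) := by
  set l := lift B.mul ∘ₗ TensorProduct.map LinearMap.id (lift B.mul) ∘ₗ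
    (TensorProduct.assoc k L L L).toLinearMap with hl
  set r := lift B.mul ∘ₗ TensorProduct.map (lift B.mul) LinearMap.id with hr
  have key : rconv l (triL B.ω) = lconv (triL B.ω) r := by
    ext x y z
    obtain ⟨n, x1, x2, hx⟩ := TensorProduct.exists_sum_tmul_eq (comul (R := k) x)
    obtain ⟨m, y1, y2, hy⟩ := TensorProduct.exists_sum_tmul_eq (comul (R := k) y)
    obtain ⟨p, z1, z2, hz⟩ := TensorProduct.exists_sum_tmul_eq (comul (R := k) z)
    have := B.quasi_assoc x y z n m p x1 x2 y1 y2 z1 z2 hx hy hz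
    simpa [conv_apply_of_comul_eq _ _ _ (comul_tmul_eq_sum (comul_tmul_eq_sum hx hy) hz),
      -Finset.univ_product_univ, Finset.sum_product, hl, hr] using this
  have h := congr(lconv (triL B.ωInv) (rconv $key (triL B.ωInv)))
  rwa [rconv_rconv, triL_ω_conv_triL_ωInv, rconv_counit, rconv_lconv, ← lconv_lconv,
    triL_ωInv_conv_triL_ω, lconv_counit] at h

lemma assoc_symm_map_comul {H X Y Z : Type*} [AddCommGroup H] [Module k H] [Coalgebra k H]
    [AddCommGroup X] [Module k X] [AddCommGroup Y] [Module k Y] [AddCommGroup Z] [Module k Z]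
    (α : H →ₗ[k] X) (β : H →ₗ[k] Y) (γ : H →ₗ[k] Z) (h : H) :
    (TensorProduct.assoc k X Y Z).symm
        (TensorProduct.map α (TensorProduct.map β γ ∘ₗ comul) (comul (R := k) h)) =
      TensorProduct.map (TensorProduct.map α β ∘ₗ comul) γ (comul (R := k) h) := by
  have e : (TensorProduct.assoc k X Y Z).symm.toLinearMap ∘ₗ
      TensorProduct.map α (TensorProduct.map β γ) =
      TensorProduct.map (TensorProduct.map α β) γ ∘ₗ
        (TensorProduct.assoc k H H H).symm.toLinearMap := by
    ext; simp
  have h1 := congr($e (comul.lTensor H (comul (R := k) h)))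
  simp only [LinearMap.comp_apply, LinearEquiv.coe_coe, Coalgebra.coassoc_symm_apply] at h1
  simpa only [LinearMap.lTensor, LinearMap.rTensor, TensorProduct.map_map, LinearMap.comp_id]
    using h1

lemma map_comul_map_comul {H : Type*} [AddCommGroup H] [Module k H] [Coalgebra k H]
    (α β γ δ : H →ₗ[k] L) (h : H) :
    TensorProduct.map (TensorProduct.map α β ∘ₗ comul) (TensorProduct.map γ δ ∘ₗ comul)
        (comul (R := k) h) =
      pairUp k L (TensorProduct.map
        (TensorProduct.map α (TensorProduct.map β γ ∘ₗ comul) ∘ₗ comul) δ (comul (R := k) h)) := by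
  have h1 : TensorProduct.map (TensorProduct.map β γ ∘ₗ comul) δ ∘ₗ comul =
      (TensorProduct.assoc k L L L).symm.toLinearMap ∘ₗ
        TensorProduct.map β (TensorProduct.map γ δ ∘ₗ comul) ∘ₗ comul :=
    LinearMap.ext fun x => (assoc_symm_map_comul β γ δ x).symm
  have h2 (y : L ⊗[k] ((L ⊗[k] L) ⊗[k] L)) :
      pairUp k L ((TensorProduct.assoc k L (L ⊗[k] L) L).symm y) =
        (TensorProduct.assoc k L L (L ⊗[k] L)).symm (TensorProduct.map LinearMap.id
          (TensorProduct.assoc k L L L).toLinearMap y) :=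
    congr((TensorProduct.assoc k L L (L ⊗[k] L)).symm (TensorProduct.map LinearMap.id
      (TensorProduct.assoc k L L L).toLinearMap
      $((TensorProduct.assoc k L (L ⊗[k] L) L).apply_symm_apply y)))
  rw [← assoc_symm_map_comul α _ δ, h2, h1, TensorProduct.map_map, ← LinearMap.comp_assoc,
    LinearEquiv.comp_symm, LinearMap.id_comp, LinearMap.id_comp, assoc_symm_map_comul]

lemma assocInv_map_comul {H : Type*} [AddCommGroup H] [Module k H] [Coalgebra k H]
    (α β γ : H →ₗ[k] L) (h : H) :
    assocInv k L (TensorProduct.map α (TensorProduct.map β γ ∘ₗ comul) (comul (R := k) h)) =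
      TensorProduct.map (TensorProduct.map α β ∘ₗ comul) γ (comul (R := k) h) :=
  assoc_symm_map_comul α β γ h

/-- `S` satisfies the axioms of a preantipode relative to the coalgebra map `f`. -/
structure IsPreantipodeAlong {H : Type*} [AddCommGroup H] [Module k H] [Coalgebra k H]
    (B : CoquasiBialgebra k L) (f : H →ₗc[k] L) (S : H →ₗ[k] L) : Prop where
  left (h : H) : TensorProduct.map B.mulHom.toLinearMap LinearMap.id
    (comul (R := k) (TensorProduct.map S f.toLinearMap (comul (R := k) h))) =
      B.one ⊗ₜ TensorProduct.map S f.toLinearMap (comul (R := k) h)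
  right (h : H) : TensorProduct.map LinearMap.id B.mulHom.toLinearMap
    (comul (R := k) (TensorProduct.map f.toLinearMap S (comul (R := k) h))) =
      TensorProduct.map f.toLinearMap S (comul (R := k) h) ⊗ₜ B.one
  ω_left (h : H) : triL B.ω (TensorProduct.map
    (TensorProduct.map f.toLinearMap S ∘ₗ comul) f.toLinearMap (comul (R := k) h)) =
      counit (R := k) h

section Strip

variable {M : Type*} [AddCommGroup M] [Module k M] {B} {θ : L ⊗[k] L} (v : L ⊗[k] L)
  {φ : L →ₗ[k] L →ₗ[k] L →ₗ[k] k}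

lemma lconv_mulFirst_tmul
    (hθ : TensorProduct.map B.mulHom.toLinearMap LinearMap.id (comul (R := k) θ) = B.one ⊗ₜ θ)
    (hφ : ∀ x y, φ B.one x y = counit (R := k) x * counit (R := k) y)
    (γ : (L ⊗[k] L) ⊗[k] (L ⊗[k] L) →ₗ[k] M) :
    lconv (triL φ ∘ₗ B.mulFirst.toLinearMap) γ (θ ⊗ₜ v) = γ (θ ⊗ₜ v) := by
  have h := conv_coinvariant_tmul_left hθ (LinearMap.lsmul k M)
    (triL φ ∘ₗ (assocInv k L).toLinearMap) γ v
  have h1 : (triL φ ∘ₗ (assocInv k L).toLinearMap) ∘ₗ TensorProduct.mk k L (L ⊗[k] L) B.one =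
      counit := by
    ext; simp [hφ, mul_comm]
  rw [h1] at h
  exact h.trans congr($(lconv_counit (γ ∘ₗ TensorProduct.mk k (L ⊗[k] L) (L ⊗[k] L) θ)) v)

lemma lconv_mulLast_tmul
    (hθ : TensorProduct.map B.mulHom.toLinearMap LinearMap.id (comul (R := k) θ) = B.one ⊗ₜ θ)
    (hφ : ∀ x y, φ x y B.one = counit (R := k) x * counit (R := k) y)
    (γ : (L ⊗[k] L) ⊗[k] (L ⊗[k] L) →ₗ[k] M) :
    lconv (triL φ ∘ₗ B.mulLast.toLinearMap) γ (v ⊗ₜ θ) = γ (v ⊗ₜ θ) := by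
  have h := conv_coinvariant_tmul_right hθ (LinearMap.lsmul k M) (triL φ) γ v
  have h1 : triL φ ∘ₗ (TensorProduct.mk k (L ⊗[k] L) L).flip B.one = counit := by
    ext; simp [hφ, mul_comm]
  rw [h1] at h
  exact h.trans congr($(lconv_counit (γ ∘ₗ (TensorProduct.mk k (L ⊗[k] L) (L ⊗[k] L)).flip θ)) v)

lemma rconv_mulFirst_tmul
    (hθ : TensorProduct.map LinearMap.id B.mulHom.toLinearMap (comul (R := k) θ) = θ ⊗ₜ B.one)
    (hφ : ∀ x y, φ B.one x y = counit (R := k) x * counit (R := k) y)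
    (γ : (L ⊗[k] L) ⊗[k] (L ⊗[k] L) →ₗ[k] M) :
    rconv γ (triL φ ∘ₗ B.mulFirst.toLinearMap) (θ ⊗ₜ v) = γ (θ ⊗ₜ v) := by
  have h := conv_tmul_left_coinvariant hθ (LinearMap.lsmul k M).flip γ
    (triL φ ∘ₗ (assocInv k L).toLinearMap) v
  have h1 : (triL φ ∘ₗ (assocInv k L).toLinearMap) ∘ₗ TensorProduct.mk k L (L ⊗[k] L) B.one =
      counit := by
    ext; simp [hφ, mul_comm]
  rw [h1] at h
  exact h.trans congr($(rconv_counit (γ ∘ₗ TensorProduct.mk k (L ⊗[k] L) (L ⊗[k] L) θ)) v)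

lemma rconv_mulLast_tmul
    (hθ : TensorProduct.map LinearMap.id B.mulHom.toLinearMap (comul (R := k) θ) = θ ⊗ₜ B.one)
    (hφ : ∀ x y, φ x y B.one = counit (R := k) x * counit (R := k) y)
    (γ : (L ⊗[k] L) ⊗[k] (L ⊗[k] L) →ₗ[k] M) :
    rconv γ (triL φ ∘ₗ B.mulLast.toLinearMap) (v ⊗ₜ θ) = γ (v ⊗ₜ θ) := by
  have h := conv_tmul_right_coinvariant hθ (LinearMap.lsmul k M).flip γ (triL φ) v
  have h1 : triL φ ∘ₗ (TensorProduct.mk k (L ⊗[k] L) L).flip B.one = counit := by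
    ext; simp [hφ, mul_comm]
  rw [h1] at h
  exact h.trans congr($(rconv_counit (γ ∘ₗ (TensorProduct.mk k (L ⊗[k] L) (L ⊗[k] L)).flip θ)) v)

end Strip

variable (k L) in
/-- The projection `(x ⊗ y) ⊗ z ↦ ε(y) ε(z) x`. -/
noncomputable def projFirst : (L ⊗[k] L) ⊗[k] L →ₗc[k] L :=
  (projLeft k L L).comp (projLeft k (L ⊗[k] L) L)

@[simp] lemma projFirst_tmul (x y z : L) :
    projFirst k L ((x ⊗ₜ y) ⊗ₜ z) = counit (R := k) z • counit (R := k) y • x := by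
  simp [projFirst]

section Middle

variable {B} {θ : L ⊗[k] L}

lemma lconv_dropFirst_mulMid_tmul
    (hθ : TensorProduct.map LinearMap.id B.mulHom.toLinearMap (comul (R := k) θ) = θ ⊗ₜ B.one)
    (s t : L) :
    lconv (triL B.ω ∘ₗ (dropFirst k L).toLinearMap) (lconv (triL B.ω ∘ₗ B.mulMid.toLinearMap)
      ((projFirst k L).toLinearMap ∘ₗ (dropLast k L).toLinearMap)) (pairUp k L ((s ⊗ₜ θ) ⊗ₜ t)) =
      triL B.ω (θ ⊗ₜ t) • s := by
  let g := Coalgebra.TensorProduct.map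
    (Coalgebra.TensorProduct.map (CoalgHom.id k L) B.mulHom) (CoalgHom.id k L)
  let j := Coalgebra.TensorProduct.map (B.oneRight L) (CoalgHom.id k L)
  have h1 : (triL B.ω ∘ₗ B.mulMid.toLinearMap) ∘ₗ (pairUp k L).toLinearMap =
      triL B.ω ∘ₗ g.toLinearMap := by
    ext; simp [g]
  have h2 : ((projFirst k L).toLinearMap ∘ₗ (dropLast k L).toLinearMap) ∘ₗ
      (pairUp k L).toLinearMap = (projFirst k L).toLinearMap ∘ₗ g.toLinearMap := by
    ext; simp [g, B.counit_mul, smul_smul, mul_comm, mul_left_comm]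
  have h3 : (triL B.ω) ∘ₗ j.toLinearMap = counit := by
    ext; simp [j, B.ω_one, mul_comm]
  have h4 : (projFirst k L).toLinearMap ∘ₗ j.toLinearMap = (projLeft k L L).toLinearMap := by
    ext; simp [j, B.counit_one]
  have h5 : ((triL B.ω ∘ₗ (dropFirst k L).toLinearMap) ∘ₗ (pairUp k L).toLinearMap) ∘ₗ
      TensorProduct.map ((TensorProduct.mk k L (L ⊗[k] L)).flip θ) LinearMap.id ∘ₗ
        (TensorProduct.mk k L L).flip t = triL B.ω (θ ⊗ₜ t) • counit := by
    ext s
    have h7 (u : L ⊗[k] L) : dropFirst k L (pairUp k L ((s ⊗ₜ u) ⊗ₜ t)) =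
        counit (R := k) s • (u ⊗ₜ t) := by
      induction u with
      | zero => simp
      | tmul x y => simp
      | add x y hx hy => simp only [add_tmul, tmul_add, map_add, hx, hy, smul_add]
    simp [h7, mul_comm]
  have h6 : lconv (triL B.ω) (projFirst k L).toLinearMap ∘ₗ
      TensorProduct.map ((TensorProduct.mk k L L).flip B.one) LinearMap.id =
      (projLeft k L L).toLinearMap := by
    have := conv_comp (LinearMap.lsmul k L) (triL B.ω) (projFirst k L).toLinearMap j
    rw [h3, h4] at this
    exact this.symm.trans (lconv_counit _)
  calc _ = lconv ((triL B.ω ∘ₗ (dropFirst k L).toLinearMap) ∘ₗ (pairUp k L).toLinearMap)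
        (lconv (triL B.ω) (projFirst k L).toLinearMap ∘ₗ g.toLinearMap) ((s ⊗ₜ θ) ⊗ₜ t) := by
        rw [lconv, lconv, lconv, ← conv_comp _ _ _ g, ← h1, ← h2, conv_comp, conv_comp]
        rfl
    _ = lconv (((triL B.ω ∘ₗ (dropFirst k L).toLinearMap) ∘ₗ (pairUp k L).toLinearMap) ∘ₗ
          TensorProduct.map ((TensorProduct.mk k L (L ⊗[k] L)).flip θ) LinearMap.id)
        (LinearMap.id ∘ₗ (projLeft k L L).toLinearMap) (s ⊗ₜ t) := by
        rw [LinearMap.id_comp, ← h6]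
        exact conv_tmul_mid_coinvariant hθ _ _ _ s t
    _ = lconv (triL B.ω (θ ⊗ₜ t) • counit) LinearMap.id s := by
        rw [lconv, conv_comp_projLeft, LinearMap.comp_assoc, h5]
    _ = _ := by
        have := congr($(lconv_counit (k := k) (LinearMap.id : L →ₗ[k] L)) s)
        simpa [conv, TensorProduct.map_smul_left] using congr(triL B.ω (θ ⊗ₜ t) • $this)

lemma rconv_mulMid_dropLast_tmul
    (hθ : TensorProduct.map B.mulHom.toLinearMap LinearMap.id (comul (R := k) θ) = B.one ⊗ₜ θ)
    (s t : L) :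
    rconv (rconv ((projRight k (L ⊗[k] L) L).toLinearMap ∘ₗ (dropFirst k L).toLinearMap)
      (triL B.ω ∘ₗ B.mulMid.toLinearMap)) (triL B.ω ∘ₗ (dropLast k L).toLinearMap)
      (pairUp k L ((s ⊗ₜ θ) ⊗ₜ t)) =
      triL B.ω (assocInv k L (s ⊗ₜ θ)) • t := by
  let g := Coalgebra.TensorProduct.map
    (Coalgebra.TensorProduct.map (CoalgHom.id k L) B.mulHom) (CoalgHom.id k L)
  let j := Coalgebra.TensorProduct.map (B.oneRight L) (CoalgHom.id k L)
  have h1 : (triL B.ω ∘ₗ B.mulMid.toLinearMap) ∘ₗ (pairUp k L).toLinearMap =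
      triL B.ω ∘ₗ g.toLinearMap := by
    ext; simp [g]
  have h2 : ((projRight k (L ⊗[k] L) L).toLinearMap ∘ₗ (dropFirst k L).toLinearMap) ∘ₗ
      (pairUp k L).toLinearMap = (projRight k (L ⊗[k] L) L).toLinearMap ∘ₗ g.toLinearMap := by
    ext; simp [g, B.counit_mul, smul_smul, mul_comm]
  have h3 : (triL B.ω) ∘ₗ j.toLinearMap = counit := by
    ext; simp [j, B.ω_one, mul_comm]
  have h4 : (projRight k (L ⊗[k] L) L).toLinearMap ∘ₗ j.toLinearMap =
      (projRight k L L).toLinearMap := by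
    ext; simp [j, B.counit_one]
  have h5 : ((triL B.ω ∘ₗ (dropLast k L).toLinearMap) ∘ₗ (pairUp k L).toLinearMap) ∘ₗ
      TensorProduct.map ((TensorProduct.mk k L (L ⊗[k] L)).flip θ) LinearMap.id ∘ₗ
        TensorProduct.mk k L L s = triL B.ω (assocInv k L (s ⊗ₜ θ)) • counit := by
    ext t
    have h7 (u : L ⊗[k] L) : dropLast k L (pairUp k L ((s ⊗ₜ u) ⊗ₜ t)) =
        counit (R := k) t • assocInv k L (s ⊗ₜ u) := by
      induction u with
      | zero => simp
      | tmul x y => simp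
      | add x y hx hy => simp only [add_tmul, tmul_add, map_add, hx, hy, smul_add]
    simp [h7, mul_comm]
  have h6 : rconv (projRight k (L ⊗[k] L) L).toLinearMap (triL B.ω) ∘ₗ
      TensorProduct.map ((TensorProduct.mk k L L).flip B.one) LinearMap.id =
      (projRight k L L).toLinearMap := by
    have := conv_comp (LinearMap.lsmul k L).flip (projRight k (L ⊗[k] L) L).toLinearMap
      (triL B.ω) j
    rw [h3, h4] at this
    exact this.symm.trans (rconv_counit _)
  calc _ = rconv (rconv (projRight k (L ⊗[k] L) L).toLinearMap (triL B.ω) ∘ₗ g.toLinearMap)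
        ((triL B.ω ∘ₗ (dropLast k L).toLinearMap) ∘ₗ (pairUp k L).toLinearMap)
        ((s ⊗ₜ θ) ⊗ₜ t) := by
        rw [rconv, rconv, rconv, ← conv_comp _ _ _ g, ← h1, ← h2, conv_comp, conv_comp]
        rfl
    _ = rconv (LinearMap.id ∘ₗ (projRight k L L).toLinearMap)
        (((triL B.ω ∘ₗ (dropLast k L).toLinearMap) ∘ₗ (pairUp k L).toLinearMap) ∘ₗ
          TensorProduct.map ((TensorProduct.mk k L (L ⊗[k] L)).flip θ) LinearMap.id)
        (s ⊗ₜ t) := by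
        rw [LinearMap.id_comp, ← h6]
        exact conv_coinvariant_tmul_mid hθ _ _ _ s t
    _ = rconv LinearMap.id (triL B.ω (assocInv k L (s ⊗ₜ θ)) • counit) t := by
        rw [rconv, conv_projRight_comp, LinearMap.comp_assoc, h5]
    _ = _ := by
        have := congr($(rconv_counit (k := k) (LinearMap.id : L →ₗ[k] L)) t)
        simpa [conv, TensorProduct.map_smul_right] using
          congr(triL B.ω (assocInv k L (s ⊗ₜ θ)) • $this)

end Middle

section Product

variable {B} {θ : L ⊗[k] L} (φ : L →ₗ[k] L →ₗ[k] L →ₗ[k] k)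

lemma lconv_mul_tmul
    (hθ : TensorProduct.map LinearMap.id B.mulHom.toLinearMap (comul (R := k) θ) = θ ⊗ₜ B.one)
    (s : L) :
    lconv (triL φ) (lift B.mul ∘ₗ TensorProduct.map LinearMap.id (lift B.mul) ∘ₗ
      (TensorProduct.assoc k L L L).toLinearMap) (assocInv k L (s ⊗ₜ θ)) =
    lconv (triL φ) (projFirst k L).toLinearMap (assocInv k L (s ⊗ₜ θ)) := by
  have h1 : (lift B.mul ∘ₗ TensorProduct.map LinearMap.id (lift B.mul) ∘ₗ
      (TensorProduct.assoc k L L L).toLinearMap) ∘ₗ (assocInv k L).toLinearMap =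
      lift B.mul ∘ₗ TensorProduct.map LinearMap.id B.mulHom.toLinearMap := by
    ext; simp
  have h2 : (projFirst k L).toLinearMap ∘ₗ (assocInv k L).toLinearMap =
      LinearMap.id ∘ₗ (projLeft k L (L ⊗[k] L)).toLinearMap := by
    ext; simp [smul_smul]
  have h3 : lift B.mul ∘ₗ (TensorProduct.mk k L L).flip B.one = LinearMap.id := by
    ext; simp [B.mul_one]
  have e1 := congr($(conv_comp (LinearMap.lsmul k L) (triL φ) (lift B.mul ∘ₗ
    TensorProduct.map LinearMap.id (lift B.mul) ∘ₗ (TensorProduct.assoc k L L L).toLinearMap)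
    (assocInv k L)) (s ⊗ₜ θ))
  have e2 := congr($(conv_comp (LinearMap.lsmul k L) (triL φ) (projFirst k L).toLinearMap
    (assocInv k L)) (s ⊗ₜ θ))
  rw [h1, conv_tmul_right_coinvariant hθ, h3] at e1
  rw [h2, conv_comp_projLeft] at e2
  exact e1.symm.trans e2

lemma rconv_mul_tmul
    (hθ : TensorProduct.map B.mulHom.toLinearMap LinearMap.id (comul (R := k) θ) = B.one ⊗ₜ θ)
    (t : L) :
    rconv (lift B.mul ∘ₗ TensorProduct.map (lift B.mul) LinearMap.id) (triL φ) (θ ⊗ₜ t) =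
      rconv (projRight k (L ⊗[k] L) L).toLinearMap (triL φ) (θ ⊗ₜ t) := by
  have h1 : lift B.mul ∘ₗ TensorProduct.mk k L L B.one = LinearMap.id := by
    ext; simp [B.one_mul]
  have e1 := conv_coinvariant_tmul_left hθ (LinearMap.lsmul k L).flip (lift B.mul) (triL φ) t
  have e2 := conv_projRight_comp (LinearMap.lsmul k L).flip LinearMap.id (triL φ) θ t
  rw [h1] at e1
  exact e1.trans e2.symm

end Product

namespace IsPreantipodeAlong

variable {B} {H : Type*} [AddCommGroup H] [Module k H] [Coalgebra k H] {f : H →ₗc[k] L}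
  {S T : H →ₗ[k] L}

lemma projLeft_map_comul (S : H →ₗ[k] L) (h : H) :
    projLeft k L L (TensorProduct.map S f.toLinearMap (comul (R := k) h)) = S h := by
  have hh := (ℛ k h).eq.symm
  conv_rhs => rw [← sum_counit_smul_left hh]
  conv_lhs => rw [hh]
  simp

lemma projRight_map_comul (S : H →ₗ[k] L) (h : H) :
    projRight k L L (TensorProduct.map f.toLinearMap S (comul (R := k) h)) = S h := by
  have hh := (ℛ k h).eq.symm
  conv_rhs => rw [← sum_counit_smul_right hh]
  conv_lhs => rw [hh]
  simp

lemma ω_right (hS : B.IsPreantipodeAlong f S) (h : H) :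
    triL B.ω (assocInv k L (TensorProduct.map f.toLinearMap
      (TensorProduct.map S f.toLinearMap ∘ₗ comul) (comul (R := k) h))) = counit (R := k) h := by
  rw [assocInv_map_comul, hS.ω_left]

lemma lconv_ωInv_projFirst (hS : B.IsPreantipodeAlong f S) (hT : B.IsPreantipodeAlong f T)
    (h : H) :
    lconv (triL B.ωInv) (projFirst k L).toLinearMap (TensorProduct.map
      (TensorProduct.map S f.toLinearMap ∘ₗ comul) T (comul (R := k) h)) = S h := by
  set Φ := TensorProduct.map (TensorProduct.map S f.toLinearMap ∘ₗ comul)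
    (TensorProduct.map T f.toLinearMap ∘ₗ comul) (comul (R := k) h) with hΦ
  set π := (projFirst k L).toLinearMap ∘ₗ (dropLast k L).toLinearMap with hπ
  have hh := (ℛ k h).eq.symm
  have e1 := congr($(conv_comp (LinearMap.lsmul k L) (triL B.ωInv) (projFirst k L).toLinearMap
    (dropLast k L)) Φ)
  have e2 : dropLast k L Φ = TensorProduct.map
      (TensorProduct.map S f.toLinearMap ∘ₗ comul) T (comul (R := k) h) := by
    simp only [hΦ, hh, dropLast, map_sum, TensorProduct.map_tmul, LinearMap.comp_apply]
    exact Finset.sum_congr rfl fun i _ => congr(_ ⊗ₜ[k] $(projLeft_map_comul (f := f) T _))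
  have e3 (γ : (L ⊗[k] L) ⊗[k] (L ⊗[k] L) →ₗ[k] L) :
      lconv (triL B.ω ∘ₗ B.mulFirst.toLinearMap) γ Φ = γ Φ := by
    simp only [hΦ, hh, map_sum, TensorProduct.map_tmul, LinearMap.comp_apply]
    exact Finset.sum_congr rfl fun i _ => lconv_mulFirst_tmul _ (hS.left _) B.ω_one_left γ
  have e4 (γ : (L ⊗[k] L) ⊗[k] (L ⊗[k] L) →ₗ[k] L) :
      lconv (triL B.ωInv ∘ₗ B.mulLast.toLinearMap) γ Φ = γ Φ := by
    simp only [hΦ, hh, map_sum, TensorProduct.map_tmul, LinearMap.comp_apply]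
    exact Finset.sum_congr rfl fun i _ => lconv_mulLast_tmul _ (hT.left _) B.ωInv_one_right γ
  have e5 : lconv (triL B.ω ∘ₗ (dropFirst k L).toLinearMap)
      (lconv (triL B.ω ∘ₗ B.mulMid.toLinearMap) π) Φ = S h := by
    rw [hΦ, map_comul_map_comul, ← assoc_symm_map_comul, hh]
    simp only [map_sum, TensorProduct.map_tmul, LinearMap.comp_apply]
    conv_rhs => rw [← sum_counit_smul_left hh, map_sum]
    refine Finset.sum_congr rfl fun i _ => ?_
    rw [map_smul, ← hT.ω_left]
    have hi := (ℛ k ((ℛ k h).right i)).eq.symm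
    rw [hi]
    simp only [map_sum, TensorProduct.map_tmul, LinearMap.comp_apply, tmul_sum,
      TensorProduct.assoc_symm_tmul, Finset.sum_smul]
    exact Finset.sum_congr rfl fun j _ => lconv_dropFirst_mulMid_tmul (hT.right _) _ _
  calc _ = lconv (triL B.ωInv ∘ₗ (dropLast k L).toLinearMap) π Φ := by
        rw [← e2]; exact e1.symm
    _ = lconv (triL B.ω ∘ₗ B.mulFirst.toLinearMap)
        (lconv (triL B.ωInv ∘ₗ (dropLast k L).toLinearMap) π) Φ := (e3 _).symm
    _ = lconv (triL B.ωInv ∘ₗ B.mulLast.toLinearMap)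
        (lconv (triL B.ω ∘ₗ (dropFirst k L).toLinearMap)
          (lconv (triL B.ω ∘ₗ B.mulMid.toLinearMap) π)) Φ := by
        rw [← lconv_lconv, mulFirst_conv_dropLast_inv, lconv_lconv, lconv_lconv]
    _ = S h := by rw [e4, e5]

lemma rconv_projRight_ωInv (hS : B.IsPreantipodeAlong f S) (hT : B.IsPreantipodeAlong f T)
    (h : H) :
    rconv (projRight k (L ⊗[k] L) L).toLinearMap (triL B.ωInv) (assocInv k L (TensorProduct.map S
      (TensorProduct.map f.toLinearMap T ∘ₗ comul) (comul (R := k) h))) = T h := by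
  set Φ := TensorProduct.map (TensorProduct.map f.toLinearMap S ∘ₗ comul)
    (TensorProduct.map f.toLinearMap T ∘ₗ comul) (comul (R := k) h) with hΦ
  set π := (projRight k (L ⊗[k] L) L).toLinearMap ∘ₗ (dropFirst k L).toLinearMap with hπ
  have hh := (ℛ k h).eq.symm
  have e1 := congr($(conv_comp (LinearMap.lsmul k L).flip
    (projRight k (L ⊗[k] L) L).toLinearMap (triL B.ωInv) (dropFirst k L)) Φ)
  have e2 : dropFirst k L Φ = assocInv k L (TensorProduct.map S
      (TensorProduct.map f.toLinearMap T ∘ₗ comul) (comul (R := k) h)) := by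
    simp only [hΦ, hh, dropFirst, map_sum, TensorProduct.map_tmul, LinearMap.comp_apply]
    exact Finset.sum_congr rfl fun i _ =>
      congr(assocInv k L ($(projRight_map_comul (f := f) S _) ⊗ₜ[k] _))
  have e3 (γ : (L ⊗[k] L) ⊗[k] (L ⊗[k] L) →ₗ[k] L) :
      rconv γ (triL B.ω ∘ₗ B.mulLast.toLinearMap) Φ = γ Φ := by
    simp only [hΦ, hh, map_sum, TensorProduct.map_tmul, LinearMap.comp_apply]
    exact Finset.sum_congr rfl fun i _ => rconv_mulLast_tmul _ (hT.right _) B.ω_one_right γ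
  have e4 (γ : (L ⊗[k] L) ⊗[k] (L ⊗[k] L) →ₗ[k] L) :
      rconv γ (triL B.ωInv ∘ₗ B.mulFirst.toLinearMap) Φ = γ Φ := by
    simp only [hΦ, hh, map_sum, TensorProduct.map_tmul, LinearMap.comp_apply]
    exact Finset.sum_congr rfl fun i _ => rconv_mulFirst_tmul _ (hS.right _) B.ωInv_one_left γ
  have e5 : rconv (rconv π (triL B.ω ∘ₗ B.mulMid.toLinearMap))
      (triL B.ω ∘ₗ (dropLast k L).toLinearMap) Φ = T h := by
    rw [hΦ, map_comul_map_comul, hh]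
    simp only [map_sum, TensorProduct.map_tmul, LinearMap.comp_apply]
    conv_rhs => rw [← sum_counit_smul_right hh, map_sum]
    refine Finset.sum_congr rfl fun i _ => ?_
    rw [map_smul, ← hS.ω_right]
    have hi := (ℛ k ((ℛ k h).left i)).eq.symm
    rw [hi]
    simp only [map_sum, TensorProduct.map_tmul, LinearMap.comp_apply, sum_tmul, Finset.sum_smul]
    exact Finset.sum_congr rfl fun j _ => rconv_mulMid_dropLast_tmul (hS.left _) _ _
  calc _ = rconv π (triL B.ωInv ∘ₗ (dropFirst k L).toLinearMap) Φ := by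
        rw [← e2]; exact e1.symm
    _ = rconv (rconv π (triL B.ωInv ∘ₗ (dropFirst k L).toLinearMap))
        (triL B.ω ∘ₗ B.mulLast.toLinearMap) Φ := (e3 _).symm
    _ = rconv (rconv (rconv π (triL B.ω ∘ₗ B.mulMid.toLinearMap))
        (triL B.ω ∘ₗ (dropLast k L).toLinearMap)) (triL B.ωInv ∘ₗ B.mulFirst.toLinearMap) Φ := by
        rw [rconv_rconv, dropFirst_inv_conv_mulLast, ← rconv_rconv, ← rconv_rconv]
    _ = T h := by rw [e4, e5]

/-- A preantipode relative to a coalgebra map is unique. -/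
theorem unique (hS : B.IsPreantipodeAlong f S) (hT : B.IsPreantipodeAlong f T) : S = T := by
  ext h
  have hh := (ℛ k h).eq.symm
  rw [← hS.lconv_ωInv_projFirst hT h, ← hS.rconv_projRight_ωInv hT h]
  trans lconv (triL B.ωInv) (lift B.mul ∘ₗ TensorProduct.map LinearMap.id (lift B.mul) ∘ₗ
    (TensorProduct.assoc k L L L).toLinearMap) (assocInv k L (TensorProduct.map S
      (TensorProduct.map f.toLinearMap T ∘ₗ comul) (comul (R := k) h)))
  · rw [← assocInv_map_comul, hh]
    simp only [map_sum, TensorProduct.map_tmul, LinearMap.comp_apply]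
    exact Finset.sum_congr rfl fun i _ => (lconv_mul_tmul _ (hT.right _) _).symm
  · rw [ωInv_conv_mul, assocInv_map_comul, hh]
    simp only [map_sum, TensorProduct.map_tmul, LinearMap.comp_apply]
    exact Finset.sum_congr rfl fun i _ => rconv_mul_tmul _ (hS.left _) _

end IsPreantipodeAlong

section Transport

variable {H : Type*} [AddCommGroup H] [Module k H] [Coalgebra k H] {f : H →ₗc[k] L}
  {S : H →ₗ[k] L}

/-- The map `s ⊗ t ↦ ∑ s₁t ⊗ s₂`. -/
noncomputable def comulMulLeft : L ⊗[k] L →ₗ[k] L ⊗[k] L :=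
  TensorProduct.map (lift B.mul) LinearMap.id ∘ₗ
    (TensorProduct.rightComm k L L L).toLinearMap ∘ₗ TensorProduct.map comul LinearMap.id

/-- The map `t ⊗ s ↦ ∑ s₁ ⊗ ts₂`. -/
noncomputable def comulMulRight : L ⊗[k] L →ₗ[k] L ⊗[k] L :=
  TensorProduct.map LinearMap.id (lift B.mul) ∘ₗ
    (TensorProduct.leftComm k L L L).toLinearMap ∘ₗ TensorProduct.map LinearMap.id comul

lemma comulMulLeft_tmul {ι : Type*} {u : Finset ι} {s : L} {s1 s2 : ι → L}
    (h : comul (R := k) s = ∑ i ∈ u, s1 i ⊗ₜ[k] s2 i) (t : L) :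
    B.comulMulLeft (s ⊗ₜ t) = ∑ i ∈ u, B.mul (s1 i) t ⊗ₜ s2 i := by
  simp [comulMulLeft, h, sum_tmul]

lemma comulMulRight_tmul {ι : Type*} {u : Finset ι} {s : L} {s1 s2 : ι → L}
    (h : comul (R := k) s = ∑ i ∈ u, s1 i ⊗ₜ[k] s2 i) (t : L) :
    B.comulMulRight (t ⊗ₜ s) = ∑ i ∈ u, s1 i ⊗ₜ B.mul t (s2 i) := by
  simp [comulMulRight, h, tmul_sum]

lemma map_mulHom_id_comul (x : L ⊗[k] L) :
    TensorProduct.map B.mulHom.toLinearMap LinearMap.id (comul (R := k) x) =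
      TensorProduct.assoc k L L L (TensorProduct.map B.comulMulLeft LinearMap.id
        ((TensorProduct.assoc k L L L).symm (TensorProduct.map LinearMap.id comul x))) := by
  induction x with
  | zero => simp
  | add x y hx hy => simp only [map_add, hx, hy]
  | tmul s t =>
    have hs := (ℛ k s).eq.symm
    have ht := (ℛ k t).eq.symm
    rw [comul_tmul_eq_sum hs ht, TensorProduct.map_tmul, ht]
    simp [tmul_sum, sum_tmul, B.comulMulLeft_tmul hs, Finset.sum_product_right]

lemma map_id_mulHom_comul (x : L ⊗[k] L) :
    TensorProduct.map LinearMap.id B.mulHom.toLinearMap (comul (R := k) x) =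
      (TensorProduct.assoc k L L L).symm (TensorProduct.map LinearMap.id B.comulMulRight
        (TensorProduct.assoc k L L L (TensorProduct.map comul LinearMap.id x))) := by
  induction x with
  | zero => simp
  | add x y hx hy => simp only [map_add, hx, hy]
  | tmul s t =>
    have hs := (ℛ k s).eq.symm
    have ht := (ℛ k t).eq.symm
    rw [comul_tmul_eq_sum hs ht, TensorProduct.map_tmul, hs]
    simp [tmul_sum, sum_tmul, B.comulMulRight_tmul ht, Finset.sum_product]

variable {B}

lemma IsPreantipodeAlong.of_comulMul
    (hl : ∀ h, B.comulMulLeft (TensorProduct.map S f.toLinearMap (comul (R := k) h)) =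
      B.one ⊗ₜ S h)
    (hr : ∀ h, B.comulMulRight (TensorProduct.map f.toLinearMap S (comul (R := k) h)) =
      S h ⊗ₜ B.one)
    (hω : ∀ h, triL B.ω (assocInv k L (TensorProduct.map f.toLinearMap
      (TensorProduct.map S f.toLinearMap ∘ₗ comul) (comul (R := k) h))) = counit (R := k) h) :
    B.IsPreantipodeAlong f S where
  left h := by
    have h1 : comul ∘ₗ f.toLinearMap =
        TensorProduct.map f.toLinearMap f.toLinearMap ∘ₗ comul := f.map_comp_comul.symm
    have h2 : B.comulMulLeft ∘ₗ TensorProduct.map S f.toLinearMap ∘ₗ comul =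
        TensorProduct.mk k L L B.one ∘ₗ S := LinearMap.ext hl
    rw [map_mulHom_id_comul, TensorProduct.map_map, LinearMap.id_comp, h1, assoc_symm_map_comul,
      TensorProduct.map_map, LinearMap.id_comp, h2, (ℛ k h).eq.symm]
    simp [tmul_sum]
  right h := by
    have h1 : comul ∘ₗ f.toLinearMap =
        TensorProduct.map f.toLinearMap f.toLinearMap ∘ₗ comul := f.map_comp_comul.symm
    have h2 : B.comulMulRight ∘ₗ TensorProduct.map f.toLinearMap S ∘ₗ comul =
        (TensorProduct.mk k L L).flip B.one ∘ₗ S := LinearMap.ext hr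
    rw [map_id_mulHom_comul, TensorProduct.map_map, LinearMap.id_comp, h1, ← assoc_symm_map_comul,
      LinearEquiv.apply_symm_apply, TensorProduct.map_map, LinearMap.id_comp, h2,
      (ℛ k h).eq.symm]
    simp [sum_tmul]
  ω_left h := by rw [← hω h, assocInv_map_comul]

lemma IsPreantipode.along {T : L →ₗ[k] L} (hT : B.IsPreantipode T) :
    B.IsPreantipodeAlong f (T ∘ₗ f.toLinearMap) := by
  have hf {h : H} {n : ℕ} {a b : Fin n → H} (hab : comul (R := k) h = ∑ i, a i ⊗ₜ[k] b i) :
      comul (R := k) (f h) = ∑ i, f (a i) ⊗ₜ[k] f (b i) := by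
    rw [← CoalgHomClass.map_comp_comul_apply, hab]
    simp
  refine .of_comulMul (fun h => ?_) (fun h => ?_) (fun h => ?_) <;>
    obtain ⟨n, a, b, hab⟩ := TensorProduct.exists_sum_tmul_eq (comul (R := k) h)
  · choose m c d hcd using fun i => TensorProduct.exists_sum_tmul_eq (comul (R := k) (T (f (a i))))
    refine Eq.trans ?_ (hT.1 (f h) n _ _ m c d (hf hab) hcd)
    simp only [hab, map_sum, TensorProduct.map_tmul, LinearMap.comp_apply]
    exact Finset.sum_congr rfl fun i _ => B.comulMulLeft_tmul (hcd i) _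
  · choose m c d hcd using fun i => TensorProduct.exists_sum_tmul_eq (comul (R := k) (T (f (b i))))
    refine Eq.trans ?_ (hT.2.1 (f h) n _ _ m c d (hf hab) hcd)
    simp only [hab, map_sum, TensorProduct.map_tmul, LinearMap.comp_apply]
    exact Finset.sum_congr rfl fun i _ => B.comulMulRight_tmul (hcd i) _
  · choose m c d hcd using fun i => TensorProduct.exists_sum_tmul_eq (comul (R := k) (b i))
    refine Eq.trans ?_ ((hT.2.2 (f h) n _ _ m _ _ (hf hab) fun i => hf (hcd i)).trans
      (CoalgHomClass.counit_comp_apply f h))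
    simp [hab, hcd, tmul_sum]

lemma IsPreantipode.map {BH : CoquasiBialgebra k H} {T : H →ₗ[k] H} (hT : BH.IsPreantipode T)
    (hmul : ∀ x y, f (BH.mul x y) = B.mul (f x) (f y)) (hone : f BH.one = B.one)
    (hω : ∀ x y z, B.ω (f x) (f y) (f z) = BH.ω x y z) :
    B.IsPreantipodeAlong f (f.toLinearMap ∘ₗ T) := by
  have hf {h : H} {n : ℕ} {a b : Fin n → H} (hab : comul (R := k) h = ∑ i, a i ⊗ₜ[k] b i) :
      comul (R := k) (f h) = ∑ i, f (a i) ⊗ₜ[k] f (b i) := by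
    rw [← CoalgHomClass.map_comp_comul_apply, hab]
    simp
  have hmul' (x y : H) : f.toLinearMap (BH.mul x y) = B.mul (f.toLinearMap x) (f.toLinearMap y) :=
    hmul x y
  have hone' : f.toLinearMap BH.one = B.one := hone
  refine .of_comulMul (fun h => ?_) (fun h => ?_) (fun h => ?_) <;>
    obtain ⟨n, a, b, hab⟩ := TensorProduct.exists_sum_tmul_eq (comul (R := k) h)
  · choose m c d hcd using fun i => TensorProduct.exists_sum_tmul_eq (comul (R := k) (T (a i)))
    have := congr(TensorProduct.map f.toLinearMap f.toLinearMap $(hT.1 h n a b m c d hab hcd))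
    simp only [map_sum, TensorProduct.map_tmul, hmul', hone'] at this
    refine Eq.trans ?_ this
    simp only [hab, map_sum, TensorProduct.map_tmul, LinearMap.comp_apply]
    exact Finset.sum_congr rfl fun i _ => B.comulMulLeft_tmul (hf (hcd i)) _
  · choose m c d hcd using fun i => TensorProduct.exists_sum_tmul_eq (comul (R := k) (T (b i)))
    have := congr(TensorProduct.map f.toLinearMap f.toLinearMap $(hT.2.1 h n a b m c d hab hcd))
    simp only [map_sum, TensorProduct.map_tmul, hmul', hone'] at this
    refine Eq.trans ?_ this
    simp only [hab, map_sum, TensorProduct.map_tmul, LinearMap.comp_apply]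
    exact Finset.sum_congr rfl fun i _ => B.comulMulRight_tmul (hf (hcd i)) _
  · choose m c d hcd using fun i => TensorProduct.exists_sum_tmul_eq (comul (R := k) (b i))
    refine Eq.trans ?_ (hT.2.2 h n _ _ m _ _ hab hcd)
    simp [hab, hcd, tmul_sum, hω]

end Transport

end CoquasiBialgebra

/-- Every morphism of `k`-flat coquasi-bialgebras with preantipodes
commutes with the preantipodes: `f ∘ S_H = S_L ∘ f`. -/
theorem coquasiBialgebraHom_comp_preantipode {k H L : Type*} [CommRing k]
    [AddCommGroup H] [Module k H] [Coalgebra k H]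
    [AddCommGroup L] [Module k L] [Coalgebra k L]
    [Module.Flat k H] [Module.Flat k L]
    (BH : CoquasiBialgebra k H) (BL : CoquasiBialgebra k L)
    (SH : H →ₗ[k] H) (hSH : BH.IsPreantipode SH)
    (SL : L →ₗ[k] L) (hSL : BL.IsPreantipode SL)
    (f : H →ₗ[k] L)
    (hf_comul : Coalgebra.comul (R := k) (A := L) ∘ₗ f =
      TensorProduct.map f f ∘ₗ Coalgebra.comul (R := k) (A := H))
    (hf_counit : Coalgebra.counit (R := k) (A := L) ∘ₗ f = Coalgebra.counit (R := k) (A := H))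
    (hf_mul : ∀ x y : H, f (BH.mul x y) = BL.mul (f x) (f y))
    (hf_one : f BH.one = BL.one)
    (hf_ω : ∀ x y z : H, BL.ω (f x) (f y) (f z) = BH.ω x y z) :
    f ∘ₗ SH = SL ∘ₗ f := by
  let fc : H →ₗc[k] L := { f with counit_comp := hf_counit, map_comp_comul := hf_comul.symm }
  exact (hSH.map (f := fc) hf_mul hf_one hf_ω).unique hSL.along
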